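/- (Finite-field Euler–Gauss summation formula.) Let α, β, γ be multiplicative characters of κ. If the pair (α,β) is not equal to (ε,γ) or (γ,ε) (i.e. the multiset {α,β} differs from the multiset {ε,γ}), then F(α,β; γ; 1) = g°(γ)·g(ᾱβ̄γ) / (g°(ᾱγ)·g°(β̄γ)). If the multiset {α,β} equals the multiset {ε,γ}, then F(α,β; γ; 1) = 1 + q^{δ(γ)}·(1−q). -/

import Mathlib

/-!
Finite-field hypergeometric functions (Otsubo), basic definitions:
`κ` is a finite field with `q = Fintype.card κ` elements, `ψ` a fixed nontrivial
additive character, multiplicative characters are `MulChar κ ℂ` (extended by `0`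
on `0`, with trivial character `1`).
-/

open scoped Classical

noncomputable section

variable {κ : Type*} [Field κ] [Fintype κ]

instance : Fintype (MulChar κ ℂ) := Fintype.ofFinite _

/-- The Gauss sum `g(φ) = -∑_{x ∈ κ} ψ(x) φ(x)`. -/
def gS (ψ : AddChar κ ℂ) (φ : MulChar κ ℂ) : ℂ := -∑ x : κ, ψ x * φ x

/-- The variant `g°(φ) = q^{δ(φ)} · g(φ)`, where `δ(φ) = 1` iff `φ` is trivial. -/
def gSo (ψ : AddChar κ ℂ) (φ : MulChar κ ℂ) : ℂ :=
  (if φ = 1 then (Fintype.card κ : ℂ) else 1) * gS ψ φ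

/-- The Pochhammer symbol `(α)_ν = g(αν)/g(α)`. -/
def poch (ψ : AddChar κ ℂ) (α ν : MulChar κ ℂ) : ℂ := gS ψ (α * ν) / gS ψ α

/-- The variant Pochhammer symbol `(α)°_ν = g°(αν)/g°(α)`. -/
def pocho (ψ : AddChar κ ℂ) (α ν : MulChar κ ℂ) : ℂ := gSo ψ (α * ν) / gSo ψ α

/-- The finite hypergeometric function
`F(α₁,…,α_r; β₁,…,β_s; λ) = (1/(1-q)) ∑_ν ((α₁)_ν ⋯ (α_r)_ν / ((ε)°_ν (β₁)°_ν ⋯ (β_s)°_ν)) ν(λ)`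
(the trivial character `ε = 1` appears implicitly among the lower parameters). -/
def Fh (ψ : AddChar κ ℂ) {r s : ℕ} (A : Fin r → MulChar κ ℂ) (B : Fin s → MulChar κ ℂ)
    (l : κ) : ℂ :=
  (1 - (Fintype.card κ : ℂ))⁻¹ *
    ∑ ν : MulChar κ ℂ,
      ((∏ i, poch ψ (A i) ν) / (pocho ψ 1 ν * ∏ j, pocho ψ (B j) ν)) * ν l

lemma gS_eq_neg_gaussSum (ψ : AddChar κ ℂ) (φ : MulChar κ ℂ) : gS ψ φ = -gaussSum φ ψ := by
  simp only [gS, gaussSum, mul_comm]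

lemma gS_one {ψ : AddChar κ ℂ} (hψ : ψ ≠ 1) : gS ψ 1 = 1 := by
  rw [gS_eq_neg_gaussSum, gaussSum_one_left hψ, neg_neg]

lemma gSo_one {ψ : AddChar κ ℂ} (hψ : ψ ≠ 1) : gSo ψ 1 = Fintype.card κ := by
  rw [gSo, if_pos rfl, gS_one hψ, mul_one]

lemma gSo_of_ne_one (ψ : AddChar κ ℂ) {φ : MulChar κ ℂ} (hφ : φ ≠ 1) : gSo ψ φ = gS ψ φ := by
  rw [gSo, if_neg hφ, one_mul]

lemma card_field_ne_zero : (Fintype.card κ : ℂ) ≠ 0 := Nat.cast_ne_zero.mpr Fintype.card_ne_zero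

lemma one_sub_card_field_ne_zero : (1 - Fintype.card κ : ℂ) ≠ 0 :=
  sub_ne_zero.mpr (by exact_mod_cast (Fintype.one_lt_card (α := κ)).ne)

lemma mulChar_neg_one_mul_self {F : Type*} [Field F] (φ : MulChar F ℂ) : φ (-1) * φ (-1) = 1 := by
  rw [← map_mul, neg_one_mul, neg_neg, map_one]

lemma mulChar_inv_neg_one {F : Type*} [Field F] (φ : MulChar F ℂ) : φ⁻¹ (-1) = φ (-1) := by
  rw [MulChar.inv_apply', inv_neg, inv_one]

/-- The reflection formula `g(φ) g°(φ⁻¹) = φ(-1) q`. -/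
lemma gS_mul_gSo_inv {ψ : AddChar κ ℂ} (hψ : ψ ≠ 1) (φ : MulChar κ ℂ) :
    gS ψ φ * gSo ψ φ⁻¹ = φ (-1) * Fintype.card κ := by
  by_cases hφ : φ = 1
  · subst hφ
    rw [inv_one, gS_one hψ, gSo_one hψ, MulChar.one_apply (by simp)]
  · rw [gSo_of_ne_one ψ (inv_ne_one.mpr hφ), gS_eq_neg_gaussSum, gS_eq_neg_gaussSum, neg_mul_neg,
      ← gaussSum_mul_gaussSum_eq_card hφ (AddChar.IsPrimitive.of_ne_one hψ),
      ← mul_gaussSum_inv_eq_gaussSum φ⁻¹ ψ, mulChar_inv_neg_one]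
    ring

lemma gS_ne_zero {ψ : AddChar κ ℂ} (hψ : ψ ≠ 1) (φ : MulChar κ ℂ) : gS ψ φ ≠ 0 := by
  intro h
  have h1 := gS_mul_gSo_inv hψ φ
  rw [h, zero_mul] at h1
  exact mul_ne_zero (left_ne_zero_of_mul_eq_one (mulChar_neg_one_mul_self φ))
    card_field_ne_zero h1.symm

lemma gSo_ne_zero {ψ : AddChar κ ℂ} (hψ : ψ ≠ 1) (φ : MulChar κ ℂ) : gSo ψ φ ≠ 0 := by
  unfold gSo
  refine mul_ne_zero ?_ (gS_ne_zero hψ φ)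
  split_ifs
  exacts [card_field_ne_zero, one_ne_zero]

lemma inv_gSo {ψ : AddChar κ ℂ} (hψ : ψ ≠ 1) (φ : MulChar κ ℂ) :
    (gSo ψ φ)⁻¹ = φ (-1) * gS ψ φ⁻¹ / Fintype.card κ := by
  have h := gS_mul_gSo_inv hψ φ⁻¹
  rw [inv_inv, mulChar_inv_neg_one] at h
  have hq := card_field_ne_zero (κ := κ)
  have h0 := gSo_ne_zero hψ φ
  field_simp
  linear_combination -(φ (-1)) * h - (Fintype.card κ : ℂ) * mulChar_neg_one_mul_self φ

lemma sum_mul_mulChar_eq_sum_units (f : κ → ℂ) (φ : MulChar κ ℂ) :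
    ∑ x : κ, f x * φ x = ∑ u : κˣ, f u * φ u := by
  symm
  refine Fintype.sum_of_injective Units.val Units.val_injective _ _ ?_ fun _ ↦ rfl
  intro x hx
  rw [φ.map_nonunit fun h ↦ hx ⟨h.unit, rfl⟩, mul_zero]

lemma sum_mulChar_apply_unit (a : κˣ) :
    ∑ ν : MulChar κ ℂ, ν a = if a = 1 then (Fintype.card κ : ℂ) - 1 else 0 := by
  split_ifs with ha
  · subst ha
    have h := MulChar.card_eq_card_units_of_hasEnoughRootsOfUnity κ ℂ
    rw [Nat.card_eq_fintype_card, Nat.card_eq_fintype_card] at h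
    have h' := Fintype.card_eq_card_units_add_one (α := κ)
    simp [h, h']
  · obtain ⟨χ, hχ⟩ := MulChar.exists_apply_ne_one_of_hasEnoughRootsOfUnity κ ℂ
      (a := (a : κ)) (by simpa using ha)
    refine eq_zero_of_mul_eq_self_left hχ ?_
    simp only [Finset.mul_sum, ← MulChar.mul_apply]
    exact Fintype.sum_bijective _ (Group.mulLeft_bijective χ) _ _ fun χ' ↦ rfl

lemma gS_eq_neg_sum_units (ψ : AddChar κ ℂ) (φ : MulChar κ ℂ) :
    gS ψ φ = -∑ u : κˣ, ψ u * φ u := by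
  rw [gS, sum_mul_mulChar_eq_sum_units]

/-- A sum over the torus `x y = w z`, parametrized by `x = w s` and `y = w t`. -/
lemma sum_units_torus (ψ : AddChar κ ℂ) (α β γ : MulChar κ ℂ) (w : κˣ) :
    ∑ x : κˣ, ∑ y : κˣ,
      ψ x * α x * (ψ y * β y) * (ψ w * γ⁻¹ w) * ψ ((x * y * w⁻¹ : κˣ) : κ) =
    ∑ s : κˣ, ∑ t : κˣ,
      α s * β t * (ψ ((w : κ) * ((1 + s) * (1 + t))) * (α * β * γ⁻¹) w) := by
  rw [← Equiv.sum_comp (Equiv.mulLeft w)]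
  refine Finset.sum_congr rfl fun s _ ↦ ?_
  rw [← Equiv.sum_comp (Equiv.mulLeft w)]
  refine Finset.sum_congr rfl fun t _ ↦ ?_
  simp only [Equiv.coe_mulLeft]
  have hw : (w : κ) * ((1 + s) * (1 + t)) =
      w * s + w * t + w + ((w * s * (w * t) * w⁻¹ : κˣ) : κ) := by
    have h : w * s * (w * t) * w⁻¹ = w * s * t := by
      rw [mul_inv_eq_iff_eq_mul]
      ac_rfl
    rw [h]
    push_cast
    ring
  rw [hw]
  simp only [AddChar.map_add_eq_mul, MulChar.mul_apply, Units.val_mul, map_mul]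
  ring

lemma sum_sum_mulChar_eq_sum_units (f : κ → κ → κ → ℂ) (α β η : MulChar κ ℂ) :
    ∑ s : κ, ∑ t : κ, α s * β t * ∑ w : κ, f s t w * η w =
      ∑ w : κˣ, ∑ s : κˣ, ∑ t : κˣ, α s * β t * (f s t w * η w) := by
  calc
    _ = ∑ s : κ, (∑ t : κ, (∑ w : κˣ, f s t w * η w) * β t) * α s := by
      simp only [sum_mul_mulChar_eq_sum_units (f _ _), Finset.sum_mul]
      refine Finset.sum_congr rfl fun s _ ↦ Finset.sum_congr rfl fun t _ ↦ ?_
      rw [Finset.mul_sum]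
      exact Finset.sum_congr rfl fun w _ ↦ by ring
    _ = ∑ s : κˣ, ∑ t : κˣ, ∑ w : κˣ, α s * β t * (f s t w * η w) := by
      rw [sum_mul_mulChar_eq_sum_units
        (fun s ↦ ∑ t : κ, (∑ w : κˣ, f s t w * η w) * β t)]
      refine Finset.sum_congr rfl fun s _ ↦ ?_
      rw [sum_mul_mulChar_eq_sum_units (fun t ↦ ∑ w : κˣ, f s t w * η w), Finset.sum_mul]
      refine Finset.sum_congr rfl fun t _ ↦ ?_
      rw [Finset.sum_mul, Finset.sum_mul]
      exact Finset.sum_congr rfl fun w _ ↦ by ring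
    _ = _ := (Finset.sum_congr rfl fun _ _ ↦ Finset.sum_comm).trans Finset.sum_comm

/-- Orthogonality of characters turns the product of four Gauss sums, summed over all characters,
into a character sum over the torus. -/
lemma sum_gS_mul_gS_mul_gS_mul_gS (ψ : AddChar κ ℂ) (α β γ : MulChar κ ℂ) :
    ∑ ν : MulChar κ ℂ, gS ψ (α * ν) * gS ψ (β * ν) * gS ψ ν⁻¹ * gS ψ (γ * ν)⁻¹ =
      ((Fintype.card κ : ℂ) - 1) * ∑ s : κ, ∑ t : κ, α s * β t *
        ∑ w : κ, ψ (w * ((1 + s) * (1 + t))) * (α * β * γ⁻¹) w := by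
  have hexp (ν : MulChar κ ℂ) :
      gS ψ (α * ν) * gS ψ (β * ν) * gS ψ ν⁻¹ * gS ψ (γ * ν)⁻¹ =
        ∑ x : κˣ, ∑ y : κˣ, ∑ w : κˣ, ∑ z : κˣ,
          ψ x * α x * (ψ y * β y) * (ψ w * γ⁻¹ w) * ψ z * ν ((x * y * w⁻¹ * z⁻¹ : κˣ) : κ) := by
    simp only [gS_eq_neg_sum_units]
    rw [neg_mul_neg, mul_assoc, neg_mul_neg, mul_comm (∑ u : κˣ, ψ u * ν⁻¹ u),
      Finset.sum_mul_sum, Finset.sum_mul_sum, Finset.sum_mul]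
    refine Finset.sum_congr rfl fun x _ ↦ ?_
    rw [Finset.sum_mul]
    refine Finset.sum_congr rfl fun y _ ↦ ?_
    rw [Finset.mul_sum]
    refine Finset.sum_congr rfl fun w _ ↦ ?_
    rw [Finset.mul_sum]
    refine Finset.sum_congr rfl fun z _ ↦ ?_
    simp only [mul_inv, MulChar.mul_apply, MulChar.inv_apply', Units.val_mul, map_mul,
      Units.val_inv_eq_inv_val]
    ring
  have hort (x y w : κˣ) :
      ∑ z : κˣ, ∑ ν : MulChar κ ℂ,
        ψ x * α x * (ψ y * β y) * (ψ w * γ⁻¹ w) * ψ z * ν ((x * y * w⁻¹ * z⁻¹ : κˣ) : κ) =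
      ((Fintype.card κ : ℂ) - 1) *
        (ψ x * α x * (ψ y * β y) * (ψ w * γ⁻¹ w) * ψ ((x * y * w⁻¹ : κˣ) : κ)) := by
    simp only [← Finset.mul_sum, sum_mulChar_apply_unit, mul_inv_eq_one, mul_ite, mul_zero,
      Finset.sum_ite_eq, Finset.mem_univ, if_true]
    ring
  calc
    _ = ∑ x : κˣ, ∑ y : κˣ, ∑ w : κˣ, ∑ z : κˣ, ∑ ν : MulChar κ ℂ,
          ψ x * α x * (ψ y * β y) * (ψ w * γ⁻¹ w) * ψ z *
            ν ((x * y * w⁻¹ * z⁻¹ : κˣ) : κ) := by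
      simp only [hexp]
      rw [Finset.sum_comm]
      refine Finset.sum_congr rfl fun x _ ↦ ?_
      rw [Finset.sum_comm]
      refine Finset.sum_congr rfl fun y _ ↦ ?_
      rw [Finset.sum_comm]
      exact Finset.sum_congr rfl fun w _ ↦ Finset.sum_comm
    _ = ((Fintype.card κ : ℂ) - 1) * ∑ w : κˣ, ∑ x : κˣ, ∑ y : κˣ,
          (ψ x * α x * (ψ y * β y) * (ψ w * γ⁻¹ w) * ψ ((x * y * w⁻¹ : κˣ) : κ)) := by
      simp only [hort]
      simp only [← Finset.mul_sum]
      congr 1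
      exact (Finset.sum_congr rfl fun x _ ↦ Finset.sum_comm).trans Finset.sum_comm
    _ = _ := by
      simp only [sum_units_torus]
      rw [sum_sum_mulChar_eq_sum_units (fun s t w ↦ ψ (w * ((1 + s) * (1 + t))))]

lemma sum_addChar_mul_mulChar {ψ : AddChar κ ℂ} (η : MulChar κ ℂ) {c : κ} (hc : c ≠ 0) :
    ∑ w : κ, ψ (w * c) * η w = -gS ψ η * η⁻¹ c := by
  have h := gaussSum_mulShift_eq η ψ (Units.mk0 c hc)
  simp only [gaussSum, AddChar.mulShift_apply, Units.val_mk0] at h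
  simp only [mul_comm (ψ _), mul_comm _ c]
  rw [h, gS_eq_neg_gaussSum, gaussSum]
  ring

/-- The Jacobi sum in terms of `g` and `g°`. -/
lemma sum_mulChar_mul_mulChar_one_add {ψ : AddChar κ ℂ} (hψ : ψ ≠ 1) (α φ : MulChar κ ℂ)
    (hφ : φ ≠ 1) :
    ∑ s : κ, α s * φ (1 + s) = -(α (-1) * gS ψ α * gS ψ φ / gSo ψ (α * φ)) := by
  have hJ : ∑ s : κ, α s * φ (1 + s) = α (-1) * jacobiSum α φ := by
    rw [jacobiSum, Finset.mul_sum, ← Equiv.sum_comp (Equiv.neg κ)]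
    refine Finset.sum_congr rfl fun s _ ↦ ?_
    rw [Equiv.neg_apply, ← mul_assoc, ← map_mul, neg_one_mul, sub_eq_add_neg]
  rw [hJ]
  by_cases h : α * φ = 1
  · obtain rfl : α = φ⁻¹ := eq_inv_of_mul_eq_one_left h
    have h1 := jacobiSum_nontrivial_inv (inv_ne_one.mpr hφ)
    have h2 := gS_mul_gSo_inv hψ φ
    have hq := card_field_ne_zero (κ := κ)
    rw [inv_inv] at h1
    rw [gSo_of_ne_one ψ (inv_ne_one.mpr hφ)] at h2
    rw [h1, h, gSo_one hψ, mulChar_inv_neg_one]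
    field_simp
    linear_combination φ (-1) * h2
  · have h1 := jacobiSum_mul_nontrivial h ψ
    have h0 := gS_ne_zero hψ (α * φ)
    rw [gSo_of_ne_one ψ h]
    field_simp
    simp only [gS_eq_neg_gaussSum]
    linear_combination -(α (-1)) * h1

lemma Fh_eq {ψ : AddChar κ ℂ} (hψ : ψ ≠ 1) (α β γ : MulChar κ ℂ) :
    Fh ψ ![α, β] ![γ] 1 = -(γ (-1) * gSo ψ γ / (Fintype.card κ * gS ψ α * gS ψ β)) *
      ∑ s : κ, ∑ t : κ, α s * β t *
        ∑ w : κ, ψ (w * ((1 + s) * (1 + t))) * (α * β * γ⁻¹) w := by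
  have hq := card_field_ne_zero (κ := κ)
  have hq1 := one_sub_card_field_ne_zero (κ := κ)
  have hterm (ν : MulChar κ ℂ) :
      ((∏ i, poch ψ (![α, β] i) ν) / (pocho ψ 1 ν * ∏ j, pocho ψ (![γ] j) ν)) * ν 1 =
        γ (-1) * gSo ψ γ / (Fintype.card κ * gS ψ α * gS ψ β) *
          (gS ψ (α * ν) * gS ψ (β * ν) * gS ψ ν⁻¹ * gS ψ (γ * ν)⁻¹) := by
    have h1 := inv_gSo hψ ν
    have h2 := inv_gSo hψ (γ * ν)
    simp only [poch, pocho, Fin.prod_univ_two, Fin.prod_univ_one, Matrix.cons_val_zero,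
      Matrix.cons_val_one, one_mul, map_one, mul_one, gSo_one hψ, div_eq_mul_inv, mul_inv, inv_inv,
      h1, h2, MulChar.mul_apply]
    have h3 := mulChar_neg_one_mul_self ν
    field_simp
    linear_combination (gS ψ (α * ν) * gS ψ (β * ν) * gS ψ ν⁻¹ * γ (-1) *
      gS ψ (γ⁻¹ * ν⁻¹) * gSo ψ γ * (gS ψ α)⁻¹ * (gS ψ β)⁻¹) * h3
  rw [Fh, Finset.sum_congr rfl fun ν _ ↦ hterm ν, ← Finset.mul_sum, sum_gS_mul_gS_mul_gS_mul_gS]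
  field_simp
  ring

lemma sum_sum_of_ne_one {ψ : AddChar κ ℂ} (α β : MulChar κ ℂ) {η : MulChar κ ℂ} (hη : η ≠ 1) :
    ∑ s : κ, ∑ t : κ, α s * β t * ∑ w : κ, ψ (w * ((1 + s) * (1 + t))) * η w =
      -gS ψ η * ((∑ s : κ, α s * η⁻¹ (1 + s)) * ∑ t : κ, β t * η⁻¹ (1 + t)) := by
  have hw (s t : κ) : ∑ w : κ, ψ (w * ((1 + s) * (1 + t))) * η w =
      -gS ψ η * (η⁻¹ (1 + s) * η⁻¹ (1 + t)) := by
    rw [← map_mul]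
    by_cases hc : (1 + s) * (1 + t) = 0
    · simp [hc, MulChar.sum_eq_zero_of_ne_one hη, MulChar.map_zero]
    · exact sum_addChar_mul_mulChar η hc
  rw [Finset.sum_mul_sum, Finset.mul_sum]
  refine Finset.sum_congr rfl fun s _ ↦ ?_
  rw [Finset.mul_sum]
  refine Finset.sum_congr rfl fun t _ ↦ ?_
  rw [hw]
  ring

lemma sum_mulChar_one : ∑ x : κ, (1 : MulChar κ ℂ) x = Fintype.card κ - 1 := by
  rw [MulChar.sum_one_eq_card_units, Fintype.card_eq_card_units_add_one (α := κ)]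
  simp

lemma sum_sum_one {ψ : AddChar κ ℂ} (hψ : ψ ≠ 1) (α β : MulChar κ ℂ) :
    ∑ s : κ, ∑ t : κ, α s * β t * ∑ w : κ, ψ (w * ((1 + s) * (1 + t))) * (1 : MulChar κ ℂ) w =
      Fintype.card κ * (α (-1) * ∑ t, β t + (∑ s, α s) * β (-1) - α (-1) * β (-1)) -
        (∑ s, α s) * ∑ t, β t := by
  have hw (s t : κ) : ∑ w : κ, ψ (w * ((1 + s) * (1 + t))) * (1 : MulChar κ ℂ) w =
      Fintype.card κ * ((if s = -1 then 1 else 0) + (if t = -1 then 1 else 0) -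
        (if s = -1 then 1 else 0) * (if t = -1 then 1 else 0)) - 1 := by
    have hs : s = -1 ↔ 1 + s = 0 := by rw [add_comm, eq_neg_iff_add_eq_zero]
    have ht : t = -1 ↔ 1 + t = 0 := by rw [add_comm, eq_neg_iff_add_eq_zero]
    by_cases hc : (1 + s) * (1 + t) = 0
    · simp only [hc, mul_zero, AddChar.map_zero_eq_one, one_mul, sum_mulChar_one]
      rcases mul_eq_zero.mp hc with h | h
      · simp [hs.mpr h]
      · simp [ht.mpr h]
    · rw [sum_addChar_mul_mulChar 1 hc, gS_one hψ, inv_one,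
        MulChar.one_apply (isUnit_iff_ne_zero.mpr hc)]
      simp [hs, ht, left_ne_zero_of_mul hc, right_ne_zero_of_mul hc]
  have hδ (φ : MulChar κ ℂ) : ∑ s : κ, φ s * (if s = -1 then 1 else 0) = φ (-1) := by
    simp
  have hterm (s t : κ) :
      α s * β t * ∑ w : κ, ψ (w * ((1 + s) * (1 + t))) * (1 : MulChar κ ℂ) w =
        Fintype.card κ * ((α s * (if s = -1 then 1 else 0)) * β t +
          α s * (β t * (if t = -1 then 1 else 0)) -
          (α s * (if s = -1 then 1 else 0)) * (β t * (if t = -1 then 1 else 0))) -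
        α s * β t := by
    rw [hw]
    ring
  simp only [hterm, Finset.sum_sub_distrib, Finset.sum_add_distrib, ← Finset.mul_sum, hδ,
    ← Finset.sum_mul]

lemma Fh_pair_of_ne_one {ψ : AddChar κ ℂ} (hψ : ψ ≠ 1) {α β γ : MulChar κ ℂ}
    (h : α * β * γ⁻¹ ≠ 1) :
    Fh ψ ![α, β] ![γ] 1 =
      gSo ψ γ * gS ψ (α⁻¹ * β⁻¹ * γ) / (gSo ψ (α⁻¹ * γ) * gSo ψ (β⁻¹ * γ)) := by
  have hη := inv_ne_one.mpr h
  rw [Fh_eq hψ, sum_sum_of_ne_one α β h, sum_mulChar_mul_mulChar_one_add hψ α _ hη,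
    sum_mulChar_mul_mulChar_one_add hψ β _ hη]
  have e1 : (α * β * γ⁻¹)⁻¹ = α⁻¹ * β⁻¹ * γ := by rw [mul_inv, mul_inv, inv_inv]
  have e2 : α * (α⁻¹ * β⁻¹ * γ) = β⁻¹ * γ := by group
  have e3 : β * (α⁻¹ * β⁻¹ * γ) = α⁻¹ * γ := by
    rw [mul_comm α⁻¹, mul_assoc β⁻¹, mul_inv_cancel_left]
  have href := gS_mul_gSo_inv hψ (α * β * γ⁻¹)
  rw [gSo_of_ne_one ψ hη, MulChar.mul_apply, MulChar.mul_apply, mulChar_inv_neg_one] at href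
  rw [e1] at href ⊢
  rw [e2, e3]
  have hq := card_field_ne_zero (κ := κ)
  have hα := gS_ne_zero hψ α
  have hβ := gS_ne_zero hψ β
  have h1 := gSo_ne_zero hψ (α⁻¹ * γ)
  have h2 := gSo_ne_zero hψ (β⁻¹ * γ)
  have ha := mulChar_neg_one_mul_self α
  have hb := mulChar_neg_one_mul_self β
  have hc := mulChar_neg_one_mul_self γ
  have hsign : γ (-1) * α (-1) * β (-1) *
      (gS ψ (α * β * γ⁻¹) * gS ψ (α⁻¹ * β⁻¹ * γ)) = Fintype.card κ := by
    rw [href]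
    linear_combination (Fintype.card κ : ℂ) *
      (α (-1) * α (-1) * β (-1) * β (-1) * hc + α (-1) * α (-1) * hb + ha)
  field_simp
  linear_combination gSo ψ γ * gS ψ (α⁻¹ * β⁻¹ * γ) * hsign

lemma Fh_pair_mul {ψ : AddChar κ ℂ} (hψ : ψ ≠ 1) (α β : MulChar κ ℂ) :
    Fh ψ ![α, β] ![α * β] 1 =
      -(α (-1) * β (-1) * gSo ψ (α * β) / (Fintype.card κ * gS ψ α * gS ψ β)) *
      (Fintype.card κ * (α (-1) * ∑ t, β t + (∑ s, α s) * β (-1) - α (-1) * β (-1)) -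
        (∑ s, α s) * ∑ t, β t) := by
  rw [Fh_eq hψ, mul_inv_cancel, sum_sum_one hψ, MulChar.mul_apply]

lemma Fh_pair_mul_of_ne_one {ψ : AddChar κ ℂ} (hψ : ψ ≠ 1) {α β : MulChar κ ℂ}
    (hα : α ≠ 1) (hβ : β ≠ 1) :
    Fh ψ ![α, β] ![α * β] 1 = gSo ψ (α * β) / (gS ψ α * gS ψ β) := by
  rw [Fh_pair_mul hψ, MulChar.sum_eq_zero_of_ne_one hα, MulChar.sum_eq_zero_of_ne_one hβ]
  have hq := card_field_ne_zero (κ := κ)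
  have hα := gS_ne_zero hψ α
  have hβ := gS_ne_zero hψ β
  have ha := mulChar_neg_one_mul_self α
  have hb := mulChar_neg_one_mul_self β
  field_simp
  linear_combination Fintype.card κ * gSo ψ (α * β) * (β (-1) * β (-1) * ha + hb)

lemma Fh_pair_one {ψ : AddChar κ ℂ} (hψ : ψ ≠ 1) (γ : MulChar κ ℂ) :
    Fh ψ ![1, γ] ![γ] 1 =
      1 + (if γ = 1 then (Fintype.card κ : ℂ) else 1) * (1 - Fintype.card κ) := by
  have h := Fh_pair_mul hψ 1 γ
  have hq := card_field_ne_zero (κ := κ)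
  have hγ := gS_ne_zero hψ γ
  have hc := mulChar_neg_one_mul_self γ
  rw [one_mul] at h
  rw [h, gSo, gS_one hψ, sum_mulChar_one, MulChar.one_apply (by simp : IsUnit (-1 : κ))]
  split_ifs with h1
  · subst h1
    rw [sum_mulChar_one, MulChar.one_apply (by simp : IsUnit (-1 : κ))]
    field_simp
    ring
  · rw [MulChar.sum_eq_zero_of_ne_one h1]
    field_simp
    linear_combination (Fintype.card κ : ℂ) * (2 - Fintype.card κ) * hc

lemma Fh_pair_comm (ψ : AddChar κ ℂ) (α β γ : MulChar κ ℂ) (l : κ) :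
    Fh ψ ![α, β] ![γ] l = Fh ψ ![β, α] ![γ] l := by
  simp only [Fh, Fin.prod_univ_two, Matrix.cons_val_zero, Matrix.cons_val_one,
    mul_comm (poch ψ α _)]

/-- finite-field Euler–Gauss summation: if the multiset `{α,β}` differs
from `{ε,γ}` then `F(α,β;γ;1) = g°(γ)g(ᾱβ̄γ)/(g°(ᾱγ)g°(β̄γ))`; if `{α,β} = {ε,γ}` then
`F(α,β;γ;1) = 1 + q^{δ(γ)}(1-q)`. -/
theorem stmt_12 (ψ : AddChar κ ℂ) (hψ : ψ ≠ 1) (α β γ : MulChar κ ℂ) :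
    (({α, β} : Multiset (MulChar κ ℂ)) ≠ {1, γ} →
      Fh ψ ![α, β] ![γ] 1 =
        gSo ψ γ * gS ψ (α⁻¹ * β⁻¹ * γ) /
          (gSo ψ (α⁻¹ * γ) * gSo ψ (β⁻¹ * γ))) ∧
    (({α, β} : Multiset (MulChar κ ℂ)) = {1, γ} →
      Fh ψ ![α, β] ![γ] 1 =
        1 + (if γ = 1 then (Fintype.card κ : ℂ) else 1) *
          (1 - (Fintype.card κ : ℂ))) := by
  constructor
  · intro h
    by_cases hη : α * β * γ⁻¹ = 1
    · obtain rfl : α * β = γ := mul_inv_eq_one.mp hη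
      have hα : α ≠ 1 := by
        rintro rfl
        exact h (by rw [one_mul])
      have hβ : β ≠ 1 := by
        rintro rfl
        exact h (by rw [mul_one, Multiset.pair_comm])
      have e : α⁻¹ * β⁻¹ * (α * β) = 1 := by rw [← mul_inv, inv_mul_cancel]
      have e' : β⁻¹ * (α * β) = α := by rw [mul_comm α, inv_mul_cancel_left]
      rw [Fh_pair_mul_of_ne_one hψ hα hβ, e, gS_one hψ, mul_one, inv_mul_cancel_left, e',
        gSo_of_ne_one ψ hα, gSo_of_ne_one ψ hβ, mul_comm (gS ψ β)]
    · exact Fh_pair_of_ne_one hψ hη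
  · intro h
    have hα : α = 1 ∨ α = γ := by
      have hmem : α ∈ ({1, γ} : Multiset (MulChar κ ℂ)) := h ▸ Multiset.mem_cons_self α _
      simpa using hmem
    rcases hα with rfl | rfl
    · obtain rfl : β = γ := Multiset.singleton_inj.mp ((Multiset.cons_inj_right _).mp h)
      exact Fh_pair_one hψ β
    · rw [Multiset.pair_comm 1] at h
      obtain rfl : β = 1 := Multiset.singleton_inj.mp ((Multiset.cons_inj_right _).mp h)
      rw [Fh_pair_comm]
      exact Fh_pair_one hψ α

end
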